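/- Given an order-n PDS (P, D, Σ), a labelling function Λ : P → 2^Prop, a valuation function V assigning a regular set of configurations to each variable, and a formula φ of the alternation-free μ-calculus, one can construct an n-store multi-automaton A such that L(A) = ⟦φ⟧_V; in particular, the set of configurations satisfying φ is regular. -/

import Mathlib

namespace HOPDS

/-- `St α k` is the type of order-`(k+1)` stores over the alphabet `α`
(so an `n`-store, for `n ≥ 1`, is a term of type `St α (n-1)`).
An order-1 store is a finite word; an order-`(k+2)` store is a nonempty
list (encoded as head plus tail of the list) of order-`(k+1)` stores. -/
def St (α : Type) : ℕ → Type
  | 0 => List α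
  | k + 1 => St α k × List (St α k)

/-- the `top₁` symbol of a store (`none` on an empty order-1 store) -/
def St.top1 {α : Type} : (k : ℕ) → St α k → Option α
  | 0, w => List.head? w
  | k + 1, s => St.top1 k s.1

/-- Stack operations: `pushw w` is `push_w` (with `pop₁ = push_ε`);
`push l` / `pop l` are `push_l` / `pop_l`. -/
inductive Op (α : Type) where
  | pushw : List α → Op α
  | push : ℕ → Op α
  | pop : ℕ → Op α

/-- `Op.Valid n o` says that `o` belongs to `O_n`. -/
def Op.Valid {α : Type} (n : ℕ) : Op α → Prop
  | .pushw _ => True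
  | .push l => 2 ≤ l ∧ l ≤ n
  | .pop l => 2 ≤ l ∧ l ≤ n

/-- partial application of a stack operation to an order-`(k+1)` store -/
def Op.apply {α : Type} : (k : ℕ) → Op α → St α k → Option (St α k)
  | 0, .pushw w, s =>
      match (s : List α) with
      | [] => none
      | _ :: t => some ((w ++ t : List α))
  | 0, .push _, _ => none
  | 0, .pop _, _ => none
  | k + 1, .pushw w, s =>
      (Op.apply k (.pushw w) s.1).map fun t' => ((t', s.2) : St α (k+1))
  | k + 1, .push l, s =>
      if l = k + 2 then some ((s.1, s.1 :: s.2) : St α (k+1))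
      else (Op.apply k (.push l) s.1).map fun t' => ((t', s.2) : St α (k+1))
  | k + 1, .pop l, s =>
      if l = k + 2 then
        match s.2 with
        | [] => none
        | r :: rs => some ((r, rs) : St α (k+1))
      else (Op.apply k (.pop l) s.1).map fun t' => ((t', s.2) : St α (k+1))

/-- configurations of an order-`(k+1)` pushdown system -/
abbrev PConf (P α : Type) (k : ℕ) := P × St α k

/-- one transition `⟨p,γ⟩ ↪ ⟨p',γ'⟩` of an order-`(k+1)` PDS with commands `D` -/
def PStep {P α : Type} {k : ℕ} (D : Set (P × α × Op α × P)) (c c' : PConf P α k) : Prop :=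
  ∃ a o, (c.1, a, o, c'.1) ∈ D ∧ St.top1 k c.2 = some a ∧ Op.apply k o c.2 = some c'.2

def PPreStar {P α : Type} {k : ℕ} (D : Set (P × α × Op α × P)) (C : Set (PConf P α k)) :
    Set (PConf P α k) :=
  {c | ∃ c' ∈ C, Relation.ReflTransGen (PStep D) c c'}

def PPrePlus {P α : Type} {k : ℕ} (D : Set (P × α × Op α × P)) (C : Set (PConf P α k)) :
    Set (PConf P α k) :=
  {c | ∃ c' ∈ C, Relation.TransGen (PStep D) c c'}

/-- configurations of an order-`(k+1)` alternating PDS; `none` is the undefined store `∇` -/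
abbrev AConf (P α : Type) (k : ℕ) := P × Option (St α k)

/-- `⟨p,γ⟩ ↪ C` for an APDS with commands `D ⊆ P × Σ × 2^(O_n × P)` -/
def AStep {P α : Type} {k : ℕ} (D : Set (P × α × Set (Op α × P)))
    (c : AConf P α k) (C : Set (AConf P α k)) : Prop :=
  ∃ p γ a OP, c = (p, some γ) ∧ (p, a, OP) ∈ D ∧ St.top1 k γ = some a ∧
    C = {c' | ∃ o p' δ, (o, p') ∈ OP ∧ Op.apply k o γ = some δ ∧ c' = (p', some δ)}
      ∪ {c' | (∃ o p', (o, p') ∈ OP ∧ Op.apply k o γ = none) ∧ c' = (p, none)}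

/-- extension of `↪` to sets of configurations -/
def ASetStep {P α : Type} {k : ℕ} (D : Set (P × α × Set (Op α × P)))
    (X Y : Set (AConf P α k)) : Prop :=
  ∃ c C C', AStep D c C ∧ c ∉ C' ∧ X = insert c C' ∧ Y = C' ∪ C

/-- `Pre*(C_Init)` for an APDS: the configurations `c` with `{c} ↪* C ⊆ C_Init` -/
def APreStar {P α : Type} {k : ℕ} (D : Set (P × α × Set (Op α × P)))
    (CI : Set (AConf P α k)) : Set (AConf P α k) :=
  {c | ∃ C, Relation.ReflTransGen (ASetStep D) {c} C ∧ C ⊆ CI}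

/-- one alternating step: choose one transition from every state of `S` and union the targets -/
def setStep {L : Type} (tr : ℕ → L → Set ℕ → Prop) (l : L) (S S' : Set ℕ) : Prop :=
  ∃ f : ℕ → Set ℕ, (∀ q ∈ S, tr q l (f q)) ∧ S' = ⋃ q ∈ S, f q

/-- alternating run over a word of labels -/
inductive listRun {L : Type} (tr : ℕ → L → Set ℕ → Prop) : List L → Set ℕ → Set ℕ → Prop
  | nil (S : Set ℕ) : listRun tr [] S S
  | cons {l : L} {ls : List L} {S S1 S2 : Set ℕ} :
      setStep tr l S S1 → listRun tr ls S1 S2 → listRun tr (l :: ls) S S2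

/-- Alternating order-`(k+1)` store automata: states drawn from `ℕ`, a finite list of
transitions labelled (at higher orders) by order-`k` store automata, an initial state,
and a finite list of final states. -/
def SA (α : Type) : ℕ → Type
  | 0 => List (ℕ × α × List ℕ) × ℕ × List ℕ
  | k + 1 => List (ℕ × SA α k × List ℕ) × ℕ × List ℕ

/-- the initial state of a store automaton -/
def SA.init {α : Type} : (k : ℕ) → SA α k → ℕ
  | 0, A => A.2.1
  | _ + 1, A => A.2.1

/-- acceptance of an order-`(k+1)` store from state `q`: an alternating run over the
word of (sub)stores ending in a set of final states, where at each step every label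
must accept the store being read -/
def SA.accFrom {α : Type} : (k : ℕ) → SA α k → ℕ → St α k → Prop
  | 0, A, q, w =>
      ∃ S, listRun (fun q' a T => ∃ L, (q', a, L) ∈ A.1 ∧ T = {x | x ∈ L})
          (w : List α) {q} S ∧
        S ⊆ {x | x ∈ A.2.2}
  | k + 1, A, q, s =>
      ∃ S,
        listRun
          (fun q' γ T => ∃ B L, (q', B, L) ∈ A.1 ∧ SA.accFrom k B (SA.init k B) γ ∧
            T = {x | x ∈ L})
          (s.1 :: s.2) {q} S ∧
        S ⊆ {x | x ∈ A.2.2}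

/-- acceptance from the initial state -/
def SA.acc {α : Type} {k : ℕ} (A : SA α k) (s : St α k) : Prop :=
  SA.accFrom k A (SA.init k A) s

/-- size of a store automaton (transitions counted recursively) -/
def SA.size {α : Type} : (k : ℕ) → SA α k → ℕ
  | 0, A => A.1.length + A.2.2.length + 1
  | k + 1, A =>
      (A.1.map fun t => SA.size k t.2.1 + t.2.2.length + 1).sum + A.2.2.length + 1

/-- An order-`(k+1)`-store multi-automaton: a shared store automaton together with
one initial state per control state, and possible `∇`-transitions (`nabla p` holds iff
there is a transition `q^p —∇→ {q^ε_f}`). -/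
structure MSA (α P : Type) (k : ℕ) where
  core : SA α k
  inits : P → ℕ
  nabla : Set P

/-- the set of configurations accepted by a multi-automaton -/
def MSA.Lang {α P : Type} {k : ℕ} (M : MSA α P k) : Set (AConf P α k) :=
  {c | (∃ s, c.2 = some s ∧ SA.accFrom k M.core (M.inits c.1) s) ∨
       (c.2 = none ∧ c.1 ∈ M.nabla)}

def MSA.size {α P : Type} {k : ℕ} (M : MSA α P k) : ℕ := SA.size k M.core

/-- regular sets of configurations: those recognised by a store multi-automaton -/
def Regular {α P : Type} {k : ℕ} (C : Set (AConf P α k)) : Prop :=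
  ∃ M : MSA α P k, M.Lang = C

/-- tower of exponentials: `tower n x = exp_n(x)` -/
def tower : ℕ → ℕ → ℕ
  | 0, x => x
  | n + 1, x => 2 ^ tower n x

/-- Büchi acceptance: an infinite run visiting accepting control states infinitely often -/
def BuchiAcc {P α : Type} {k : ℕ} (D : Set (P × α × Op α × P)) (F : Set P)
    (c : PConf P α k) : Prop :=
  ∃ r : ℕ → PConf P α k,
    r 0 = c ∧ (∀ i, PStep D (r i) (r (i + 1))) ∧ ∀ i, ∃ j, i ≤ j ∧ (r j).1 ∈ F

/-- the store `[^n a]^n` (each level a singleton) -/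
def unitSt {α : Type} (a : α) : (k : ℕ) → St α k
  | 0 => [a]
  | k + 1 => ((unitSt a k, []) : St α (k+1))

/-- Eloise's attractor for a reachability game with step relation `step`,
Eloise-owned configurations `E` and target set `R`:  `Attr_E(R) = ⋃ᵢ Attrⁱ_E(R)`. -/
def AttrE {C : Type} (step : C → C → Prop) (E : Set C) (R : Set C) : Set C :=
  ⋃ i,
    (fun X => X ∪ {c | c ∈ E ∧ ∃ c', step c c' ∧ c' ∈ X}
                ∪ {c | c ∉ E ∧ ∀ c', step c c' → c' ∈ X})^[i] R

end HOPDS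

namespace HOPDS

/-- formulae of the propositional μ-calculus in positive normal form, over atomic
propositions `Prop0` and variables `V` -/
inductive Mu (Prop0 V : Type) where
  | atom : Prop0 → Mu Prop0 V
  | natom : Prop0 → Mu Prop0 V
  | var : V → Mu Prop0 V
  | or : Mu Prop0 V → Mu Prop0 V → Mu Prop0 V
  | and : Mu Prop0 V → Mu Prop0 V → Mu Prop0 V
  | dia : Mu Prop0 V → Mu Prop0 V
  | box : Mu Prop0 V → Mu Prop0 V
  | mu : V → Mu Prop0 V → Mu Prop0 V
  | nu : V → Mu Prop0 V → Mu Prop0 V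

variable {Prop0 V : Type}

/-- semantics `⟦φ⟧_V` over the configurations of an order-`(k+1)` PDS with commands `D`
and labelling `Λ`, relative to a valuation `ρ` of the variables -/
def Mu.sem {P α : Type} {k : ℕ} [DecidableEq V]
    (D : Set (P × α × Op α × P)) (Λ : P → Set Prop0) :
    Mu Prop0 V → (V → Set (PConf P α k)) → Set (PConf P α k)
  | .atom π, _ => {c | π ∈ Λ c.1}
  | .natom π, _ => {c | π ∉ Λ c.1}
  | .var X, ρ => ρ X
  | .or φ ψ, ρ => Mu.sem D Λ φ ρ ∪ Mu.sem D Λ ψ ρ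
  | .and φ ψ, ρ => Mu.sem D Λ φ ρ ∩ Mu.sem D Λ ψ ρ
  | .dia φ, ρ => {c | ∃ c', PStep D c c' ∧ c' ∈ Mu.sem D Λ φ ρ}
  | .box φ, ρ => {c | ∀ c', PStep D c c' → c' ∈ Mu.sem D Λ φ ρ}
  | .mu X φ, ρ => ⋂₀ {C | Mu.sem D Λ φ (Function.update ρ X C) ⊆ C}
  | .nu X φ, ρ => ⋃₀ {C | C ⊆ Mu.sem D Λ φ (Function.update ρ X C)}

/-- substitution of `θ` for the free occurrences of the variable `X` -/
def Mu.subst [DecidableEq V] (X : V) (θ : Mu Prop0 V) : Mu Prop0 V → Mu Prop0 V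
  | .atom π => .atom π
  | .natom π => .natom π
  | .var Y => if Y = X then θ else .var Y
  | .or φ ψ => .or (Mu.subst X θ φ) (Mu.subst X θ ψ)
  | .and φ ψ => .and (Mu.subst X θ φ) (Mu.subst X θ ψ)
  | .dia φ => .dia (Mu.subst X θ φ)
  | .box φ => .box (Mu.subst X θ φ)
  | .mu Y φ => if Y = X then .mu Y φ else .mu Y (Mu.subst X θ φ)
  | .nu Y φ => if Y = X then .nu Y φ else .nu Y (Mu.subst X θ φ)

/-- `X` occurs free in the formula -/
def Mu.FreeIn (X : V) : Mu Prop0 V → Prop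
  | .atom _ => False
  | .natom _ => False
  | .var Y => Y = X
  | .or φ ψ => Mu.FreeIn X φ ∨ Mu.FreeIn X ψ
  | .and φ ψ => Mu.FreeIn X φ ∨ Mu.FreeIn X ψ
  | .dia φ => Mu.FreeIn X φ
  | .box φ => Mu.FreeIn X φ
  | .mu Y φ => Y ≠ X ∧ Mu.FreeIn X φ
  | .nu Y φ => Y ≠ X ∧ Mu.FreeIn X φ

/-- every σ-subformula is a μ-formula (no `ν` occurs) -/
def Mu.NuFree : Mu Prop0 V → Prop
  | .atom _ => True
  | .natom _ => True
  | .var _ => True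
  | .or φ ψ => Mu.NuFree φ ∧ Mu.NuFree ψ
  | .and φ ψ => Mu.NuFree φ ∧ Mu.NuFree ψ
  | .dia φ => Mu.NuFree φ
  | .box φ => Mu.NuFree φ
  | .mu _ φ => Mu.NuFree φ
  | .nu _ _ => False

/-- the set of (syntactic) subformulae -/
def Mu.Subf : Mu Prop0 V → Set (Mu Prop0 V)
  | .atom π => {.atom π}
  | .natom π => {.natom π}
  | .var X => {.var X}
  | .or φ ψ => insert (.or φ ψ) (Mu.Subf φ ∪ Mu.Subf ψ)
  | .and φ ψ => insert (.and φ ψ) (Mu.Subf φ ∪ Mu.Subf ψ)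
  | .dia φ => insert (.dia φ) (Mu.Subf φ)
  | .box φ => insert (.box φ) (Mu.Subf φ)
  | .mu X φ => insert (.mu X φ) (Mu.Subf φ)
  | .nu X φ => insert (.nu X φ) (Mu.Subf φ)

/-- `X` occurs (free or bound) in the formula -/
def Mu.Occurs (X : V) : Mu Prop0 V → Prop
  | .atom _ => False
  | .natom _ => False
  | .var Y => Y = X
  | .or φ ψ => Mu.Occurs X φ ∨ Mu.Occurs X ψ
  | .and φ ψ => Mu.Occurs X φ ∨ Mu.Occurs X ψ
  | .dia φ => Mu.Occurs X φ
  | .box φ => Mu.Occurs X φ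
  | .mu _ φ => Mu.Occurs X φ
  | .nu _ φ => Mu.Occurs X φ

/-- alternation-freedom: in every μ-subformula `μX.θ` all ν-subformulae of `θ` are proper
(contain no occurrence of `X`), and dually for ν-subformulae -/
def Mu.AltFree (φ0 : Mu Prop0 V) : Prop :=
  ∀ ψ ∈ Mu.Subf φ0,
    (∀ (X : V) (θ : Mu Prop0 V), ψ = Mu.mu X θ →
      ∀ ξ ∈ Mu.Subf θ, (∃ (Y : V) (τ : Mu Prop0 V), ξ = Mu.nu Y τ) → ¬ Mu.Occurs X ξ) ∧
    (∀ (X : V) (θ : Mu Prop0 V), ψ = Mu.nu X θ →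
      ∀ ξ ∈ Mu.Subf θ, (∃ (Y : V) (τ : Mu Prop0 V), ξ = Mu.mu Y τ) → ¬ Mu.Occurs X ξ)

/-- the store is well-bottomed: every order-1 stack is of the form `u ++ [⊥]` with
`⊥ ∉ u` -/
def WB {α : Type} (bot : α) : (k : ℕ) → St α k → Prop
  | 0, w => ∃ u, (w : List α) = u ++ [bot] ∧ bot ∉ u
  | k + 1, s => WB bot k s.1 ∧ ∀ s' ∈ s.2, WB bot k s'

/-- the bottom-of-stack discipline for commands: `⊥` is never pushed nor popped, except
by commands of the form `(_, ⊥, push_⊥, _)` (i.e. `push_w` commands that read `⊥` must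
rewrite `w = u ++ [⊥]` with `⊥ ∉ u`, and those that do not read `⊥` never mention it) -/
def BotDisc {P α : Type} (bot : α) (D : Set (P × α × Op α × P)) : Prop :=
  ∀ x ∈ D, ∀ w : List α, x.2.2.1 = Op.pushw w →
    ((x.2.1 = bot → ∃ u, w = u ++ [bot] ∧ bot ∉ u) ∧ (x.2.1 ≠ bot → bot ∉ w))

end HOPDS

namespace HOPDS

section Regularity

variable {α : Type}

/-- the order-`(k+2)` store with top substore `t` and remaining substores `ts` -/
def St.mk {k : ℕ} (t : St α k) (ts : List (St α k)) : St α (k + 1) := (t, ts)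

/-- `RegFun k f`: the value of `f` on an order-`(k+1)` store is computed by a finite
deterministic device that reads the store from the bottom up; at higher orders it reads the
images of the substores under a finite colouring that is itself `RegFun k`. -/
def RegFun : (k : ℕ) → {X : Type} → (St α k → X) → Prop
  | 0, X, f => ∃ (H : Type) (_ : Finite H) (h₀ : H) (δ : α → H → H) (out : H → X),
      ∀ w : List α, f w = out (w.foldr δ h₀)
  | k + 1, X, f => ∃ (A : Type) (_ : Finite A) (c : St α k → A) (_ : RegFun k c)
      (H : Type) (_ : Finite H) (h₀ : H) (δ : A → H → H) (out : H → X),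
      ∀ t ts, f (St.mk t ts) = out ((t :: ts).foldr (fun t h => δ (c t) h) h₀)

theorem RegFun.comp {k : ℕ} {X Y : Type} {f : St α k → X} (hf : RegFun k f) (g : X → Y) :
    RegFun k (fun s => g (f s)) := by
  cases k with
  | zero =>
    obtain ⟨H, hH, h₀, δ, out, h⟩ := hf
    exact ⟨H, hH, h₀, δ, fun x => g (out x), fun w => congrArg g (h w)⟩
  | succ k =>
    obtain ⟨A, hA, c, hc, H, hH, h₀, δ, out, h⟩ := hf
    exact ⟨A, hA, c, hc, H, hH, h₀, δ, fun x => g (out x), fun t ts => congrArg g (h t ts)⟩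

theorem foldr_prodMk {S H K : Type} (d : S → H → H) (e : S → K → K) (h₀ : H) (k₀ : K)
    (l : List S) :
    l.foldr (fun s (x : H × K) => (d s x.1, e s x.2)) (h₀, k₀) =
      (l.foldr d h₀, l.foldr e k₀) := by
  induction l with
  | nil => rfl
  | cons s l ih => simp [ih]

theorem foldr_pi {S I : Type} {H : I → Type} (d : ∀ i, S → H i → H i) (h₀ : ∀ i, H i)
    (l : List S) :
    l.foldr (fun s (x : ∀ i, H i) i => d i s (x i)) h₀ = fun i => l.foldr (d i) (h₀ i) := by
  induction l with
  | nil => rfl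
  | cons s l ih => simp [ih]

theorem RegFun.prodMk {k : ℕ} {X Y : Type} {f : St α k → X} {g : St α k → Y}
    (hf : RegFun k f) (hg : RegFun k g) : RegFun k (fun s => (f s, g s)) := by
  induction k generalizing X Y with
  | zero =>
    obtain ⟨H, hH, h₀, δ, out, h⟩ := hf
    obtain ⟨H', hH', h₀', δ', out', h'⟩ := hg
    refine ⟨H × H', inferInstance, (h₀, h₀'), fun a x => (δ a x.1, δ' a x.2),
      fun x => (out x.1, out' x.2), fun w => ?_⟩
    rw [foldr_prodMk]
    exact Prod.ext (h w) (h' w)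
  | succ k ih =>
    obtain ⟨A, hA, c, hc, H, hH, h₀, δ, out, h⟩ := hf
    obtain ⟨A', hA', c', hc', H', hH', h₀', δ', out', h'⟩ := hg
    refine ⟨A × A', inferInstance, _, ih hc hc', H × H', inferInstance, (h₀, h₀'),
      fun a x => (δ a.1 x.1, δ' a.2 x.2), fun x => (out x.1, out' x.2), fun t ts => ?_⟩
    rw [foldr_prodMk (fun t h => δ (c t) h) (fun t h => δ' (c' t) h)]
    exact Prod.ext (h t ts) (h' t ts)

theorem RegFun.pi {k : ℕ} {I : Type} [Finite I] {X : I → Type} {f : ∀ i, St α k → X i}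
    (hf : ∀ i, RegFun k (f i)) : RegFun k (fun s i => f i s) := by
  induction k generalizing X with
  | zero =>
    choose H hH h₀ δ out h using hf
    refine ⟨∀ i, H i, inferInstance, h₀, fun a x i => δ i a (x i), fun x i => out i (x i),
      fun w => ?_⟩
    rw [foldr_pi δ]
    exact funext fun i => h i w
  | succ k ih =>
    choose A hA c hc H hH h₀ δ out h using hf
    refine ⟨∀ i, A i, inferInstance, _, ih hc, ∀ i, H i, inferInstance, h₀,
      fun a x i => δ i (a i) (x i), fun x i => out i (x i), fun t ts => ?_⟩
    rw [foldr_pi (fun i t h => δ i (c i t) h)]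
    exact funext fun i => h i t ts

theorem RegFun.top1 [Finite α] : (k : ℕ) → RegFun k (St.top1 (α := α) k)
  | 0 => ⟨Option α, inferInstance, none, fun a _ => some a, id, fun w => by cases w <;> rfl⟩
  | k + 1 => ⟨Option α, inferInstance, _, RegFun.top1 k, Option α, inferInstance, none,
      fun a _ => a, id, fun _ _ => rfl⟩

theorem RegFun.const [Finite α] {k : ℕ} {X : Type} (x : X) :
    RegFun (α := α) k (fun _ => x) :=
  (RegFun.top1 k).comp fun _ => x

theorem Op.apply_succ_eq_map {k : ℕ} {o : Op α} (h₁ : o ≠ .push (k + 2))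
    (h₂ : o ≠ .pop (k + 2)) (t : St α k) (ts : List (St α k)) :
    Op.apply (k + 1) o (St.mk t ts) = (Op.apply k o t).map fun t' => St.mk t' ts := by
  cases o with
  | pushw w => rfl
  | push l => exact if_neg fun h => h₁ (congrArg Op.push h)
  | pop l => exact if_neg fun h => h₂ (congrArg Op.pop h)

theorem Op.apply_succ_push {k : ℕ} (t : St α k) (ts : List (St α k)) :
    Op.apply (k + 1) (.push (k + 2)) (St.mk t ts) = some (St.mk t (t :: ts)) :=
  if_pos rfl

theorem Op.apply_succ_pop_nil {k : ℕ} (t : St α k) :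
    Op.apply (k + 1) (.pop (k + 2)) (St.mk t []) = none :=
  if_pos rfl

theorem Op.apply_succ_pop_cons {k : ℕ} (t r : St α k) (rs : List (St α k)) :
    Op.apply (k + 1) (.pop (k + 2)) (St.mk t (r :: rs)) = some (St.mk r rs) :=
  if_pos rfl

theorem RegFun.apply_eq_none (o : Op α) : (k : ℕ) → RegFun k (fun s => Op.apply k o s = none)
  | 0 => by
    refine ⟨Bool, inferInstance, true, fun _ _ => false,
      fun b => (∀ v, o = .pushw v → b = true), fun w => ?_⟩
    cases o <;> cases w <;> simp [Op.apply]
  | k + 1 => by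
    refine ⟨Prop, inferInstance, _, RegFun.apply_eq_none o k, Option (Prop × Prop),
      inferInstance, none, fun a h => some (a, h = none),
      fun x => ∃ y, x = some y ∧ o ≠ .push (k + 2) ∧ ((o = .pop (k + 2) ∧ y.2) ∨
        (o ≠ .pop (k + 2) ∧ y.1)), fun t ts => ?_⟩
    by_cases h₁ : o = .push (k + 2)
    · subst h₁
      simp [Op.apply_succ_push]
    by_cases h₂ : o = .pop (k + 2)
    · subst h₂
      cases ts with
      | nil => simp [Op.apply_succ_pop_nil]
      | cons r rs => simp [Op.apply_succ_pop_cons]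
    · simp [Op.apply_succ_eq_map h₁ h₂, h₁, h₂]

end Regularity

section LeastFixpoint

variable {α O : Type}

/-- A move of an alternating system: stay (`none`) or apply one of the named operations. -/
def move (ι : O → Op α) (k : ℕ) : Option O → St α k → Option (St α k)
  | none, s => some s
  | some o, s => Op.apply k (ι o) s

/-- The least fixpoint of an alternating system on stores: the state `q` holds at the store `s`
if some set `Y` of moves offered by `rule s q` consists of moves that are defined at `s` and lead
to valid state-store pairs. -/
inductive Holds (ι : O → Op α) {k : ℕ} {Q : Type}
    (rule : St α k → Q → (Option O × Q → Prop) → Prop) : St α k → Q → Prop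
  | intro {s : St α k} {q : Q} (Y : Option O × Q → Prop) (g : Option O × Q → St α k) :
      rule s q Y → (∀ m, Y m → move ι k m.1 s = some (g m)) →
      (∀ m, Y m → Holds ι rule (g m) m.2) → Holds ι rule s q

variable {ι : O → Op α} {k : ℕ} {Q : Type}
  {rule : St α k → Q → (Option O × Q → Prop) → Prop}

theorem Holds.mk {s : St α k} {q : Q} (Y : Option O × Q → Prop) (hr : rule s q Y)
    (hY : ∀ m, Y m → ∃ s', move ι k m.1 s = some s' ∧ Holds ι rule s' m.2) :
    Holds ι rule s q := by
  classical
  refine Holds.intro Y (fun m => if h : Y m then (hY m h).choose else s) hr ?_ ?_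
  · intro m hm
    simp only [hm, dif_pos]
    exact (hY m hm).choose_spec.1
  · intro m hm
    simp only [hm, dif_pos]
    exact (hY m hm).choose_spec.2

theorem Holds.least {Z : St α k → Q → Prop}
    (hZ : ∀ s q Y, rule s q Y →
      (∀ m, Y m → ∃ s', move ι k m.1 s = some s' ∧ Holds ι rule s' m.2 ∧ Z s' m.2) → Z s q)
    {s : St α k} {q : Q} (h : Holds ι rule s q) : Z s q := by
  induction h with
  | intro Y g hr hm hh ih => exact hZ _ _ Y hr fun m h => ⟨g m, hm m h, hh m h, ih m h⟩

theorem Holds.append_congr {ι : O → Op α}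
    {rule : List α → Q → (Option O × Q → Prop) → Prop} {w w' : List α}
    (hrule : ∀ u : List α, rule (u ++ w) = rule (u ++ w'))
    (hval : ∀ q, Holds (k := 0) ι rule w q → Holds (k := 0) ι rule w' q)
    (u : List α) {q : Q} (h : Holds (k := 0) ι rule (u ++ w) q) :
    Holds (k := 0) ι rule (u ++ w') q := by
  refine Holds.least (k := 0) (Z := fun x q => ∀ u, x = u ++ w →
    Holds (k := 0) ι rule (u ++ w') q) ?_ h u rfl
  rintro _ q Y hr hY u rfl
  cases u with
  | nil => exact hval q (Holds.mk Y hr fun m hm => (hY m hm).imp fun _ h => ⟨h.1, h.2.1⟩)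
  | cons a u =>
    refine Holds.mk Y (hrule (a :: u) ▸ hr) fun m hm => ?_
    obtain ⟨s', h₁, -, h₃⟩ := hY m hm
    obtain ⟨_ | o, q'⟩ := m
    · cases h₁
      exact ⟨_, rfl, h₃ _ rfl⟩
    · revert h₁
      simp only [move]
      cases ι o with
      | pushw v =>
        intro h₁
        cases h₁
        exact ⟨_, rfl, List.append_assoc v u w' ▸ h₃ (v ++ u) (List.append_assoc v u w).symm⟩
      | push l => exact fun h₁ => nomatch h₁
      | pop l => exact fun h₁ => nomatch h₁

theorem exists_foldr_of_congr {S X : Type} (L : List S → X)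
    (hL : ∀ a w w', L w = L w' → L (a :: w) = L (a :: w')) :
    ∃ δ : S → X → X, ∀ w, L w = w.foldr δ (L []) := by
  classical
  refine ⟨fun a x => if h : ∃ w, L w = x then L (a :: h.choose) else x, fun w => ?_⟩
  induction w with
  | nil => rfl
  | cons a w ih =>
    have h : ∃ v, L v = L w := ⟨w, rfl⟩
    rw [List.foldr_cons, ← ih, dif_pos h]
    exact hL a _ _ h.choose_spec.symm

theorem RegFun.holds_zero [Finite Q] {rule : List α → Q → (Option O × Q → Prop) → Prop}
    (hrule : RegFun (α := α) 0 rule) :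
    RegFun (α := α) 0 (fun s q => Holds (k := 0) ι rule s q) := by
  obtain ⟨H, hH, h₀, δ, out, h⟩ := hrule
  obtain ⟨d, hd⟩ := exists_foldr_of_congr
    (fun w : List α => (w.foldr δ h₀, fun q => Holds (k := 0) ι rule w q)) (by
      intro a w w' hww'
      obtain ⟨h₁, h₂⟩ := Prod.mk.inj hww'
      have hr : ∀ u : List α, rule (u ++ w) = rule (u ++ w') := fun u => by
        simp only [h, List.foldr_append, h₁]
      refine Prod.ext (by simp [h₁]) (funext fun q => propext ⟨?_, ?_⟩)
      · exact Holds.append_congr hr (fun q => (congrFun h₂ q).mp) [a]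
      · exact Holds.append_congr (fun u => (hr u).symm) (fun q => (congrFun h₂ q).mpr) [a])
  exact ⟨H × (Q → Prop), inferInstance, _, d, Prod.snd, fun w => congrArg Prod.snd (hd w)⟩

/-- A system on order-`(k+2)` stores, turned into one on order-`(k+1)` stores. A state `(q, η, R)`
stands for `q` at a store whose tail has value `η` and satisfies at least the states in `R`:
a top-level `pop` is answered by `R`, and a top-level `push` guesses the set of states satisfied
by the pushed tail. -/
def lowerRule {A H : Type} (ι : O → Op α) (k : ℕ) (δ : A → H → H)
    (out : H → Q → (Option O × Q → Prop) → Prop) (a : A) (t : Q × H × (Q → Prop))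
    (Y : Option O × Q × H × (Q → Prop) → Prop) : Prop :=
  ∃ Y₀, out (δ a t.2.1) t.1 Y₀ ∧ ∀ m, Y₀ m →
    ((∀ o, m.1 = some o → ι o ≠ .push (k + 2) ∧ ι o ≠ .pop (k + 2)) ∧ Y (m.1, m.2, t.2)) ∨
    (∃ o, m.1 = some o ∧ ι o = .push (k + 2) ∧
      ∃ R, Y (none, m.2, δ a t.2.1, R) ∧ ∀ q, R q → Y (none, q, t.2)) ∨
    (∃ o, m.1 = some o ∧ ι o = .pop (k + 2) ∧ t.2.2 m.2)

theorem move_succ {m : Option O}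
    (hm : ∀ o, m = some o → ι o ≠ .push (k + 2) ∧ ι o ≠ .pop (k + 2)) (t : St α k)
    (ts : List (St α k)) :
    move ι (k + 1) m (St.mk t ts) = (move ι k m t).map fun t' => St.mk t' ts := by
  cases m with
  | none => rfl
  | some o => exact Op.apply_succ_eq_map (hm o rfl).1 (hm o rfl).2 t ts

theorem RegFun.holds_succ [Finite Q]
    (ih : ∀ {Q : Type} [Finite Q] {rule : St α k → Q → (Option O × Q → Prop) → Prop},
      RegFun k rule → RegFun k (fun s q => Holds ι rule s q))
    {rule : St α (k + 1) → Q → (Option O × Q → Prop) → Prop} (hrule : RegFun (k + 1) rule) :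
    RegFun (k + 1) (fun s q => Holds ι rule s q) := by
  obtain ⟨A, hA, c, hc, H, hH, h₀, δ, out, h⟩ := hrule
  let rule' := fun s => lowerRule ι k δ out (c s)
  have hreg : RegFun k (fun s q => Holds ι rule' s q) := ih (hc.comp _)
  let G : List (St α k) → H × (Q → Prop) :=
    List.foldr (fun s x => (δ (c s) x.1, fun q => Holds ι rule' s (q, x))) (h₀, fun _ => False)
  have hG₁ : ∀ l, (G l).1 = l.foldr (fun t h => δ (c t) h) h₀ := by
    intro l
    induction l with
    | nil => rfl
    | cons s l ih => exact congrArg (δ (c s)) ih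
  have hsub : ∀ s t, Holds ι rule' s t → ∀ ts : List (St α k),
      ts.foldr (fun t h => δ (c t) h) h₀ = t.2.1 →
      (∀ q, t.2.2 q → ∃ r rs, ts = r :: rs ∧ Holds ι rule (St.mk r rs) q) →
      Holds ι rule (St.mk s ts) t.1 := by
    intro s t hst
    refine Holds.least (Z := fun s t => ∀ ts : List (St α k),
      ts.foldr (fun t h => δ (c t) h) h₀ = t.2.1 →
      (∀ q, t.2.2 q → ∃ r rs, ts = r :: rs ∧ Holds ι rule (St.mk r rs) q) →
      Holds ι rule (St.mk s ts) t.1) ?_ hst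
    rintro s ⟨q, η, R⟩ Y ⟨Y₀, hout, hY₀⟩ hY ts hts hR
    refine Holds.mk Y₀ (by rw [h]; simpa [hts] using hout) fun m hm => ?_
    rcases hY₀ m hm with ⟨hm', hYm⟩ | ⟨o, ho, ho', R', hpush, hR'⟩ | ⟨o, ho, ho', hpop⟩
    · obtain ⟨s', h₁, -, h₃⟩ := hY _ hYm
      exact ⟨St.mk s' ts, by rw [move_succ hm']; exact congrArg (Option.map _) h₁, h₃ ts hts hR⟩
    · refine ⟨St.mk s (s :: ts), by rw [ho]; simp only [move, ho']; exact Op.apply_succ_push _ _, ?_⟩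
      obtain ⟨s', h₁, -, h₃⟩ := hY _ hpush
      cases h₁
      refine h₃ (s :: ts) (by simp [hts]) fun q' hq' => ⟨s, ts, rfl, ?_⟩
      obtain ⟨s', h₁, -, h₃⟩ := hY _ (hR' q' hq')
      cases h₁
      exact h₃ ts hts hR
    · obtain ⟨r, rs, rfl, hrs⟩ := hR _ hpop
      exact ⟨St.mk r rs, by rw [ho]; simp only [move, ho']; exact Op.apply_succ_pop_cons _ _ _, hrs⟩
  have hsup : ∀ t ts q, Holds ι rule (St.mk t ts) q → (G (t :: ts)).2 q := by
    intro t ts q hx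
    refine Holds.least (Z := fun (x : St α (k + 1)) q => (G (Prod.fst x :: Prod.snd x)).2 q) ?_ hx
    rintro ⟨s, ts⟩ q Y hr hY
    have hr' : out (δ (c s) (G ts).1) q Y := by
      rw [hG₁]
      exact (congrFun (congrFun (h s ts) q) Y).mp hr
    refine Holds.mk (ι := ι) (rule := rule') (q := (q, G ts))
      (fun m => ∃ s', move ι k m.1 s = some s' ∧ Holds ι rule' s' m.2)
      ⟨Y, hr', fun m hm => ?_⟩ fun m hm => hm
    obtain ⟨x', h₁, -, h₃⟩ := hY m hm
    obtain ⟨m, q'⟩ := m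
    by_cases hm' : ∀ o, m = some o → ι o ≠ .push (k + 2) ∧ ι o ≠ .pop (k + 2)
    · refine Or.inl ⟨hm', ?_⟩
      replace h₁ := (move_succ hm' s ts).symm.trans h₁
      rw [Option.map_eq_some_iff] at h₁
      obtain ⟨s', h₁, rfl⟩ := h₁
      exact ⟨s', h₁, h₃⟩
    · push Not at hm'
      obtain ⟨o, rfl, ho⟩ := hm'
      by_cases ho' : ι o = .push (k + 2)
      · simp only [move, ho'] at h₁
        cases (Op.apply_succ_push s ts).symm.trans h₁
        exact Or.inr (Or.inl ⟨o, rfl, ho', (G (s :: ts)).2, ⟨s, rfl, h₃⟩,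
          fun q hq => ⟨s, rfl, hq⟩⟩)
      · have ho'' := ho ho'
        simp only [move, ho''] at h₁
        cases ts with
        | nil => cases (Op.apply_succ_pop_nil s).symm.trans h₁
        | cons r rs =>
          cases (Op.apply_succ_pop_cons s r rs).symm.trans h₁
          exact Or.inr (Or.inr ⟨o, rfl, ho'', h₃⟩)
  have hGsub : ∀ l q, (G l).2 q →
      ∃ r rs, l = r :: rs ∧ Holds ι rule (St.mk r rs) q := by
    intro l
    induction l with
    | nil => exact fun q hq => hq.elim
    | cons s l ih =>
      exact fun q hq => ⟨s, l, rfl, hsub s (q, G l) hq l (hG₁ l).symm ih⟩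
  refine ⟨_, inferInstance, _, hc.prodMk hreg, H × (Q → Prop), inferInstance,
    (h₀, fun _ => False), fun a x => (δ a.1 x.1, fun q => a.2 (q, x)), Prod.snd, fun t ts => ?_⟩
  refine funext fun q => propext ⟨hsup t ts q, fun hq => ?_⟩
  obtain ⟨r, rs, h₁, h₂⟩ := hGsub _ q hq
  cases h₁
  exact h₂

theorem RegFun.holds (ι : O → Op α) (k : ℕ) {Q : Type} [Finite Q]
    {rule : St α k → Q → (Option O × Q → Prop) → Prop} (hrule : RegFun k rule) :
    RegFun k (fun s q => Holds ι rule s q) := by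
  induction k generalizing Q with
  | zero => exact RegFun.holds_zero hrule
  | succ k ih => exact RegFun.holds_succ (fun h => ih h) hrule

end LeastFixpoint

section Automata

variable {α : Type}

/-- Acceptance of a word by an alternating automaton, by recursion on the word. -/
def AcceptsWord {L : Type} (tr : ℕ → L → Set ℕ → Prop) (F : Set ℕ) : List L → ℕ → Prop
  | [], q => q ∈ F
  | l :: ls, q => ∃ T, tr q l T ∧ ∀ x ∈ T, AcceptsWord tr F ls x

theorem exists_listRun_iff {L : Type} (tr : ℕ → L → Set ℕ → Prop) (F : Set ℕ) (ls : List L)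
    (S : Set ℕ) :
    (∃ S', listRun tr ls S S' ∧ S' ⊆ F) ↔ ∀ q ∈ S, AcceptsWord tr F ls q := by
  induction ls generalizing S with
  | nil =>
    constructor
    · rintro ⟨_, ⟨⟩, hF⟩
      exact hF
    · exact fun h => ⟨S, .nil S, h⟩
  | cons l ls ih =>
    constructor
    · rintro ⟨S', hrun, hF⟩ q hq
      cases hrun with
      | cons hstep hrun =>
        obtain ⟨f, hf, rfl⟩ := hstep
        exact ⟨f q, hf q hq, fun x hx =>
          (ih _).mp ⟨S', hrun, hF⟩ x (Set.mem_biUnion hq hx)⟩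
    · intro h
      simp only [AcceptsWord] at h
      choose! f hf hacc using h
      obtain ⟨S', hrun, hF⟩ := (ih (⋃ q ∈ S, f q)).mpr fun x hx => by
        simp only [Set.mem_iUnion] at hx
        obtain ⟨q, hq, hx⟩ := hx
        exact hacc q hq x hx
      exact ⟨S', .cons ⟨f, hf, rfl⟩ hrun, hF⟩

theorem SA.accFrom_zero_iff (A : SA α 0) (q : ℕ) (w : List α) :
    SA.accFrom 0 A q w ↔ AcceptsWord (fun q' a T => ∃ L, (q', a, L) ∈ A.1 ∧ T = {x | x ∈ L})
      {x | x ∈ A.2.2} w q := by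
  refine (exists_listRun_iff _ _ _ _).trans ?_
  simp

theorem SA.accFrom_succ_iff {k : ℕ} (A : SA α (k + 1)) (q : ℕ) (t : St α k)
    (ts : List (St α k)) :
    SA.accFrom (k + 1) A q (St.mk t ts) ↔
      AcceptsWord (fun q' γ T => ∃ B L, (q', B, L) ∈ A.1 ∧ SA.accFrom k B (SA.init k B) γ ∧
        T = {x | x ∈ L}) {x | x ∈ A.2.2} (t :: ts) q := by
  refine (exists_listRun_iff _ _ _ _).trans ?_
  exact ⟨fun h => h q rfl, fun h _ hq => hq ▸ h⟩

theorem exists_acceptsWord_eq_foldr {S A : Type} (c : S → A) (tr : ℕ → A → Set ℕ → Prop)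
    (F B : Set ℕ) (hB : B.Finite) (hF : F ⊆ B) (htr : ∀ q a T, tr q a T → q ∈ B) :
    ∃ (H : Type) (_ : Finite H) (h₀ : H) (δ : A → H → H) (out : H → ℕ → Prop),
      ∀ l : List S, AcceptsWord (fun q s T => tr q (c s) T) F l =
        out (l.foldr (fun s h => δ (c s) h) h₀) := by
  refine ⟨{T : Set ℕ // T ⊆ B}, hB.finite_subsets, ⟨F, hF⟩,
    fun a T => ⟨{q | ∃ U, tr q a U ∧ ∀ x ∈ U, x ∈ T.1}, fun q ⟨U, hU, _⟩ => htr q a U hU⟩,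
    fun T q => q ∈ T.1, fun l => ?_⟩
  induction l with
  | nil => rfl
  | cons s l ih =>
    funext q
    simp only [AcceptsWord, ih]
    rfl

theorem finite_sources {L M : Type} (l : List (ℕ × L × M)) (f : List ℕ) :
    ({q | ∃ t ∈ l, t.1 = q} ∪ {x | x ∈ f}).Finite :=
  (l.finite_toSet.image Prod.fst).union f.finite_toSet

theorem RegFun.accFrom : {k : ℕ} → (A : SA α k) → RegFun k (fun s q => SA.accFrom k A q s)
  | 0, A => by
    obtain ⟨H, hH, h₀, δ, out, h⟩ := exists_acceptsWord_eq_foldr (S := α) id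
      (fun q' a T => ∃ L, (q', a, L) ∈ A.1 ∧ T = {x | x ∈ L}) {x | x ∈ A.2.2} _
      (finite_sources A.1 A.2.2) Set.subset_union_right
      (fun q a T ⟨L, hL, _⟩ => Or.inl ⟨_, hL, rfl⟩)
    exact ⟨H, hH, h₀, δ, out, fun w =>
      (funext fun q => propext (SA.accFrom_zero_iff A q w)).trans (h w)⟩
  | k + 1, A => by
    obtain ⟨H, hH, h₀, δ, out, h⟩ := exists_acceptsWord_eq_foldr
      (fun s (t : {t // t ∈ A.1}) => SA.accFrom k t.1.2.1 (SA.init k t.1.2.1) s)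
      (fun q' a T => ∃ t : {t // t ∈ A.1}, t.1.1 = q' ∧ a t ∧ T = {x | x ∈ t.1.2.2})
      {x | x ∈ A.2.2} _ (finite_sources A.1 A.2.2) Set.subset_union_right
      (fun q a T ⟨t, ht, _⟩ => Or.inl ⟨t.1, t.2, ht⟩)
    have : Finite {t // t ∈ A.1} := A.1.finite_toSet
    refine ⟨_, inferInstance, _,
      RegFun.pi fun t : {t // t ∈ A.1} =>
        (RegFun.accFrom t.1.2.1).comp fun x => x (SA.init k t.1.2.1),
      H, hH, h₀, δ, out, fun t ts => ?_⟩
    rw [← h]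
    refine funext fun q => propext ((SA.accFrom_succ_iff A q t ts).trans (iff_of_eq ?_))
    congr 1
    funext q s T
    refine propext ⟨?_, ?_⟩
    · rintro ⟨B, L, hmem, hacc, rfl⟩
      exact ⟨⟨_, hmem⟩, rfl, hacc, rfl⟩
    · rintro ⟨⟨⟨q, B, L⟩, hmem⟩, rfl, hacc, rfl⟩
      exact ⟨B, L, hmem, hacc, rfl⟩

theorem acceptsWord_iff_foldr {S A H : Type} (c : S → A) (h₀ : H) (δ : A → H → H)
    (e : (H → Prop) → ℕ) {tr : ℕ → S → Set ℕ → Prop} {F : Set ℕ}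
    (htr : ∀ K s T, tr (e K) s T ↔ T = {e fun h => K (δ (c s) h)})
    (hF : ∀ K, e K ∈ F ↔ K h₀) (l : List S) (K : H → Prop) :
    AcceptsWord tr F l (e K) ↔ K (l.foldr (fun s h => δ (c s) h) h₀) := by
  induction l generalizing K with
  | nil => exact hF K
  | cons s l ih => simp [AcceptsWord, htr, ih]

theorem exists_list_mem_iff_range {I X : Type} [Finite I] (f : I → X) :
    ∃ l : List X, ∀ x, x ∈ l ↔ ∃ i, f i = x :=
  ⟨(Set.finite_range f).toFinset.toList, by simp⟩

/-- `A` with initial state `i` -/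
def SA.withInit : {k : ℕ} → SA α k → ℕ → SA α k
  | 0, A, i => (A.1, i, A.2.2)
  | _ + 1, A, i => (A.1, i, A.2.2)

theorem SA.accFrom_withInit : {k : ℕ} → (A : SA α k) → (i : ℕ) → (s : St α k) →
    (SA.accFrom k (A.withInit i) (SA.init k (A.withInit i)) s ↔ SA.accFrom k A i s)
  | 0, _, _, _ => Iff.rfl
  | _ + 1, _, _, _ => Iff.rfl

theorem RegFun.exists_automaton [Finite α] {k : ℕ} {X : Type} {f : St α k → X}
    (hf : RegFun k f) :
    ∃ (A : SA α k) (i : (X → Prop) → ℕ), ∀ p s, SA.accFrom k A (i p) s ↔ p (f s) := by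
  induction k generalizing X with
  | zero =>
    obtain ⟨H, hH, h₀, δ, out, h⟩ := hf
    obtain ⟨e, he⟩ := Countable.exists_injective_nat (H → Prop)
    obtain ⟨l, hl⟩ := exists_list_mem_iff_range
      (fun x : (H → Prop) × α => (e x.1, x.2, [e fun h => x.1 (δ x.2 h)]))
    obtain ⟨F, hF⟩ := exists_list_mem_iff_range (fun K : {K : H → Prop // K h₀} => e K.1)
    refine ⟨(l, 0, F), fun p => e fun h => p (out h), fun p w => ?_⟩
    refine (SA.accFrom_zero_iff _ _ _).trans
      ((acceptsWord_iff_foldr id h₀ δ e ?_ ?_ w _).trans (iff_of_eq (congrArg p (h w).symm)))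
    · intro K a T
      constructor
      · rintro ⟨L, hL, rfl⟩
        obtain ⟨⟨K', a'⟩, hx⟩ := (hl _).mp hL
        simp only [Prod.mk.injEq] at hx
        obtain ⟨h₁, rfl, rfl⟩ := hx
        cases he h₁
        simp
      · rintro rfl
        exact ⟨_, (hl _).mpr ⟨(K, a), rfl⟩, by simp⟩
    · intro K
      refine (hF _).trans ⟨?_, fun h => ⟨⟨K, h⟩, rfl⟩⟩
      rintro ⟨⟨K', h'⟩, hx⟩
      exact he hx ▸ h'
  | succ k ih =>
    obtain ⟨A, hA, c, hc, H, hH, h₀, δ, out, h⟩ := hf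
    obtain ⟨B, i, hB⟩ := ih hc
    obtain ⟨e, he⟩ := Countable.exists_injective_nat (H → Prop)
    obtain ⟨l, hl⟩ := exists_list_mem_iff_range
      (fun x : (H → Prop) × A =>
        (e x.1, B.withInit (i fun a => a = x.2), [e fun h => x.1 (δ x.2 h)]))
    obtain ⟨F, hF⟩ := exists_list_mem_iff_range (fun K : {K : H → Prop // K h₀} => e K.1)
    refine ⟨(l, 0, F), fun p => e fun h => p (out h), fun p ⟨t, ts⟩ => ?_⟩
    refine (SA.accFrom_succ_iff _ _ t ts).trans
      ((acceptsWord_iff_foldr c h₀ δ e ?_ ?_ (t :: ts) _).trans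
        (iff_of_eq (congrArg p (h t ts).symm)))
    · intro K s T
      constructor
      · rintro ⟨B', L, hL, hacc, rfl⟩
        obtain ⟨⟨K', a'⟩, hx⟩ := (hl _).mp hL
        simp only [Prod.mk.injEq] at hx
        obtain ⟨h₁, rfl, rfl⟩ := hx
        cases he h₁
        rw [SA.accFrom_withInit, hB] at hacc
        subst hacc
        simp
      · rintro rfl
        exact ⟨_, _, (hl _).mpr ⟨(K, c s), rfl⟩, by rw [SA.accFrom_withInit, hB], by simp⟩
    · intro K
      refine (hF _).trans ⟨?_, fun h => ⟨⟨K, h⟩, rfl⟩⟩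
      rintro ⟨⟨K', h'⟩, hx⟩
      exact he hx ▸ h'

/-- a set of defined configurations, regular in the sense of `RegFun` -/
def RegConf {P : Type} {k : ℕ} (C : Set (PConf P α k)) : Prop :=
  RegFun k (fun s p => (p, s) ∈ C)

theorem regConf_of_lang {P : Type} {k : ℕ} {C : Set (PConf P α k)} (M : MSA α P k)
    (hM : M.Lang = {x : AConf P α k | ∃ s, x.2 = some s ∧ (x.1, s) ∈ C}) : RegConf C := by
  have h : (fun s p => (p, s) ∈ C) = fun s p => SA.accFrom k M.core (M.inits p) s := by
    funext s p
    have := Set.ext_iff.mp hM (p, some s)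
    simpa [MSA.Lang] using this.symm
  unfold RegConf
  rw [h]
  exact (RegFun.accFrom M.core).comp fun x p => x (M.inits p)

theorem RegConf.exists_lang [Finite α] {P : Type} {k : ℕ} {C : Set (PConf P α k)}
    (hC : RegConf C) :
    ∃ M : MSA α P k, M.Lang = {x : AConf P α k | ∃ s, x.2 = some s ∧ (x.1, s) ∈ C} := by
  obtain ⟨A, i, h⟩ := RegFun.exists_automaton hC
  refine ⟨⟨A, fun p => i fun x => x p, ∅⟩, Set.ext fun x => ?_⟩
  simp [MSA.Lang, h]

theorem RegConf.compl {P : Type} {k : ℕ} {C : Set (PConf P α k)} (hC : RegConf C) :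
    RegConf Cᶜ :=
  RegFun.comp hC fun x p => ¬ x p

end Automata

section MuCalculus

variable {α P V O : Type} {k : ℕ}

/-- The rules of an alternating system with set variables, under the valuation `ρ`: a rule may
additionally require the current store to satisfy some variables, at chosen control states. -/
def instRule {Q : Type} (rule : St α k → Q → (Option O × Q → Prop) → (V × P → Prop) → Prop)
    (ρ : V → Set (PConf P α k)) (s : St α k) (q : Q) (Y : Option O × Q → Prop) : Prop :=
  ∃ U, rule s q Y U ∧ ∀ x, U x → (x.2, s) ∈ ρ x.1

/-- operators on sets of configurations given by the least fixpoint of a regular finite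
alternating system -/
def MuDef (ι : O → Op α) (F : (V → Set (PConf P α k)) → Set (PConf P α k)) : Prop :=
  ∃ (Q : Type) (_ : Finite Q)
    (rule : St α k → Q → (Option O × Q → Prop) → (V × P → Prop) → Prop) (_ : RegFun k rule)
    (init : P → Q), ∀ ρ, F ρ = {c | Holds ι (instRule rule ρ) c.2 (init c.1)}

/-- the operators dual to those of `MuDef` -/
def NuDef (ι : O → Op α) (F : (V → Set (PConf P α k)) → Set (PConf P α k)) : Prop :=
  MuDef ι fun ρ => (F fun X => (ρ X)ᶜ)ᶜ

variable {ι : O → Op α} {F G : (V → Set (PConf P α k)) → Set (PConf P α k)}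

theorem MuDef.regConf [Finite V] (hF : MuDef ι F) {ρ : V → Set (PConf P α k)}
    (hρ : ∀ X, RegConf (ρ X)) : RegConf (F ρ) := by
  obtain ⟨Q, hQ, rule, hrule, init, h⟩ := hF
  have hinst : RegFun k (instRule rule ρ) :=
    (hrule.prodMk (RegFun.pi hρ)).comp
      fun x q Y => ∃ U, x.1 q Y U ∧ ∀ y : V × P, U y → x.2 y.1 y.2
  rw [h]
  exact (RegFun.holds ι k hinst).comp fun x p => x (init p)

theorem NuDef.regConf [Finite V] (hF : NuDef ι F) {ρ : V → Set (PConf P α k)}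
    (hρ : ∀ X, RegConf (ρ X)) : RegConf (F ρ) := by
  simpa using (MuDef.regConf hF fun X => (hρ X).compl).compl

theorem MuDef.comp [Finite P] {I : Type} [Finite I]
    {F : I → (V → Set (PConf P α k)) → Set (PConf P α k)} (hF : ∀ i, MuDef ι (F i))
    {head : St α k → P → (Option O × I × P → Prop) → Prop} (hhead : RegFun k head)
    (hG : ∀ ρ, G ρ = {c | ∃ Y, head c.2 c.1 Y ∧ ∀ m, Y m →
      ∃ s', move ι k m.1 c.2 = some s' ∧ (m.2.2, s') ∈ F m.2.1 ρ}) :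
    MuDef ι G := by
  choose Q hQ rule hrule init h using hF
  let g : (P → (Option O × I × P → Prop) → Prop) ×
      (∀ i, Q i → (Option O × Q i → Prop) → (V × P → Prop) → Prop) →
      P ⊕ (Σ i, Q i) → (Option O × (P ⊕ (Σ i, Q i)) → Prop) → (V × P → Prop) → Prop :=
    fun x q Y U => Sum.elim
      (fun p => ∃ Y₀, x.1 p Y₀ ∧ ∀ m, Y₀ m → Y (m.1, .inr ⟨m.2.1, init m.2.1 m.2.2⟩))
      (fun q => ∃ Y₀, x.2 q.1 q.2 Y₀ U ∧ ∀ m, Y₀ m → Y (m.1, .inr ⟨q.1, m.2⟩)) q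
  let rule' := fun s => g (head s, fun i => rule i s)
  have hrule' : RegFun k rule' := (hhead.prodMk (RegFun.pi hrule)).comp g
  refine ⟨_, inferInstance, rule', hrule', .inl, fun ρ => ?_⟩
  have hinr : ∀ i s q, Holds ι (instRule (rule i) ρ) s q →
      Holds ι (instRule rule' ρ) s (.inr ⟨i, q⟩) := by
    intro i s q hq
    refine Holds.least (Z := fun s q => Holds ι (instRule rule' ρ) s (.inr ⟨i, q⟩)) ?_ hq
    rintro s q Y ⟨U, hr, hU⟩ hY
    refine Holds.mk (fun m => ∃ m', Y m' ∧ m = (m'.1, .inr ⟨i, m'.2⟩))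
      ⟨U, ⟨Y, hr, fun m hm => ⟨m, hm, rfl⟩⟩, hU⟩ ?_
    rintro _ ⟨m, hm, rfl⟩
    exact (hY m hm).imp fun s' h => ⟨h.1, h.2.2⟩
  let Z : St α k → P ⊕ (Σ i, Q i) → Prop := fun s q =>
    Sum.elim (fun p => (p, s) ∈ G ρ) (fun q => Holds ι (instRule (rule q.1) ρ) s q.2) q
  have hZ : ∀ s q, Holds ι (instRule rule' ρ) s q → Z s q := by
    intro s q hq
    refine Holds.least (Z := Z) ?_ hq
    rintro s (p | ⟨i, q⟩) Y ⟨U, hr, hU⟩ hY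
    · obtain ⟨Y₀, hh, hY₀⟩ := hr
      have : ∃ Y, head s p Y ∧ ∀ m, Y m →
          ∃ s', move ι k m.1 s = some s' ∧ (m.2.2, s') ∈ F m.2.1 ρ := by
        refine ⟨Y₀, hh, fun m hm => ?_⟩
        obtain ⟨s', h₁, -, h₃⟩ := hY _ (hY₀ m hm)
        refine ⟨s', h₁, ?_⟩
        rw [h]
        exact h₃
      exact (Set.ext_iff.mp (hG ρ) (p, s)).mpr this
    · obtain ⟨Y₀, hh, hY₀⟩ := hr
      exact Holds.mk Y₀ ⟨U, hh, hU⟩ fun m hm => (hY _ (hY₀ m hm)).imp fun s' h => ⟨h.1, h.2.2⟩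
  refine Set.ext fun ⟨p, s⟩ => ⟨fun hc => ?_, hZ s (.inl p)⟩
  rw [hG] at hc
  obtain ⟨Y, hh, hY⟩ := hc
  refine Holds.mk (fun m => ∃ m', Y m' ∧ m = (m'.1, .inr ⟨m'.2.1, init m'.2.1 m'.2.2⟩))
    ⟨fun _ => False, ⟨Y, hh, fun m hm => ⟨m, hm, rfl⟩⟩, fun _ => False.elim⟩ ?_
  rintro _ ⟨m, hm, rfl⟩
  obtain ⟨s', h₁, h₂⟩ := hY m hm
  rw [h] at h₂
  exact ⟨s', h₁, hinr _ _ _ h₂⟩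

theorem MuDef.const [Finite P] {C : Set (PConf P α k)} (hC : RegConf C) :
    MuDef (V := V) ι fun _ => C :=
  MuDef.comp (I := Empty) (F := fun i => i.elim) (fun i => i.elim)
    (head := fun s p _ => (p, s) ∈ C) (RegFun.comp hC fun x p (_ : Option O × Empty × P → Prop) => x p)
    fun _ => Set.ext fun _ =>
      ⟨fun hc => ⟨fun _ => False, hc, fun _ => False.elim⟩, fun ⟨_, hc, _⟩ => hc⟩

theorem MuDef.var [Finite α] [Finite P] (X : V) :
    MuDef ι fun ρ : V → Set (PConf P α k) => ρ X := by
  refine ⟨P, inferInstance, fun _ p _ U => U (X, p), RegFun.const _, id, fun ρ => ?_⟩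
  refine Set.ext fun ⟨p, s⟩ => ⟨fun hc => ?_, fun hc => ?_⟩
  · refine Holds.mk (fun _ => False) ⟨fun x => x = (X, p), rfl, ?_⟩ fun _ => False.elim
    rintro _ rfl
    exact hc
  · refine Holds.least (Z := fun s p => (p, s) ∈ ρ X) ?_ hc
    rintro s p Y ⟨U, hr, hU⟩ -
    exact hU _ hr

theorem MuDef.union [Finite α] [Finite P] (hF : MuDef ι F) (hG : MuDef ι G) :
    MuDef ι fun ρ => F ρ ∪ G ρ := by
  refine MuDef.comp (F := fun b : Bool => cond b F G) (Bool.rec hG hF)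
    (head := fun _ p Y => Y (none, true, p) ∨ Y (none, false, p)) (RegFun.const _) fun ρ => ?_
  refine Set.ext fun ⟨p, s⟩ => ⟨?_, ?_⟩
  · rintro (h | h)
    · refine ⟨fun m => m = (none, true, p), Or.inl rfl, ?_⟩
      rintro _ rfl
      exact ⟨s, rfl, h⟩
    · refine ⟨fun m => m = (none, false, p), Or.inr rfl, ?_⟩
      rintro _ rfl
      exact ⟨s, rfl, h⟩
  · rintro ⟨Y, h | h, hY⟩
    · obtain ⟨s', h₁, h₂⟩ := hY _ h
      cases h₁
      exact Or.inl h₂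
    · obtain ⟨s', h₁, h₂⟩ := hY _ h
      cases h₁
      exact Or.inr h₂

theorem MuDef.inter [Finite α] [Finite P] (hF : MuDef ι F) (hG : MuDef ι G) :
    MuDef ι fun ρ => F ρ ∩ G ρ := by
  refine MuDef.comp (F := fun b : Bool => cond b F G) (Bool.rec hG hF)
    (head := fun _ p Y => Y (none, true, p) ∧ Y (none, false, p)) (RegFun.const _) fun ρ => ?_
  refine Set.ext fun ⟨p, s⟩ => ⟨?_, ?_⟩
  · rintro ⟨h, h'⟩
    refine ⟨fun m => m = (none, true, p) ∨ m = (none, false, p), ⟨Or.inl rfl, Or.inr rfl⟩, ?_⟩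
    rintro _ (rfl | rfl)
    · exact ⟨s, rfl, h⟩
    · exact ⟨s, rfl, h'⟩
  · rintro ⟨Y, ⟨h, h'⟩, hY⟩
    obtain ⟨_, h₁, h₂⟩ := hY _ h
    obtain ⟨_, h₁', h₂'⟩ := hY _ h'
    cases h₁
    cases h₁'
    exact ⟨h₂, h₂'⟩

variable {D : Set (P × α × Op α × P)}

theorem MuDef.dia [Finite α] [Finite P] (hι : ∀ x ∈ D, ∃ o, ι o = x.2.2.1)
    (hF : MuDef ι F) : MuDef ι fun ρ => {c | ∃ c', PStep D c c' ∧ c' ∈ F ρ} := by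
  refine MuDef.comp (I := Unit) (fun _ => hF)
    (head := fun s p Y => ∃ a o p', (p, a, ι o, p') ∈ D ∧ St.top1 k s = some a ∧
      Y (some o, (), p'))
    ((RegFun.top1 k).comp fun x p (Y : Option O × Unit × P → Prop) => ∃ a o p', (p, a, ι o, p') ∈ D ∧ x = some a ∧
      Y (some o, (), p')) fun ρ => ?_
  refine Set.ext fun ⟨p, s⟩ => ⟨?_, ?_⟩
  · rintro ⟨⟨p', s'⟩, ⟨a, o, hD, htop, happ⟩, hc⟩
    obtain ⟨o, rfl⟩ := hι _ hD
    refine ⟨fun m => m = (some o, (), p'), ⟨a, o, p', hD, htop, rfl⟩, ?_⟩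
    rintro _ rfl
    exact ⟨s', happ, hc⟩
  · rintro ⟨Y, ⟨a, o, p', hD, htop, hYo⟩, hY⟩
    obtain ⟨s', h₁, h₂⟩ := hY _ hYo
    exact ⟨(p', s'), ⟨a, ι o, hD, htop, h₁⟩, h₂⟩

theorem MuDef.box [Finite α] [Finite P] [Finite O] (hι : ∀ x ∈ D, ∃ o, ι o = x.2.2.1)
    (hF : MuDef ι F) : MuDef ι fun ρ => {c | ∀ c', PStep D c c' → c' ∈ F ρ} := by
  refine MuDef.comp (I := Unit) (fun _ => hF)
    (head := fun s p Y => ∀ a o p', (p, a, ι o, p') ∈ D → St.top1 k s = some a →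
      ¬ Op.apply k (ι o) s = none → Y (some o, (), p'))
    (((RegFun.top1 k).prodMk (RegFun.pi fun o => RegFun.apply_eq_none (ι o) k)).comp
      fun x p (Y : Option O × Unit × P → Prop) => ∀ a o p', (p, a, ι o, p') ∈ D → x.1 = some a → ¬ x.2 o →
        Y (some o, (), p')) fun ρ => ?_
  refine Set.ext fun ⟨p, s⟩ => ⟨fun h => ?_, ?_⟩
  · refine ⟨fun m => ∃ a o p', (p, a, ι o, p') ∈ D ∧ St.top1 k s = some a ∧
      Op.apply k (ι o) s ≠ none ∧ m = (some o, (), p'),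
      fun a o p' h₁ h₂ h₃ => ⟨a, o, p', h₁, h₂, h₃, rfl⟩, ?_⟩
    rintro _ ⟨a, o, p', h₁, h₂, h₃, rfl⟩
    obtain ⟨s', hs'⟩ := Option.ne_none_iff_exists'.mp h₃
    exact ⟨s', hs', h (p', s') ⟨a, ι o, h₁, h₂, hs'⟩⟩
  · rintro ⟨Y, hh, hY⟩ ⟨p', s'⟩ ⟨a, o, hD, htop, happ⟩
    obtain ⟨o, rfl⟩ := hι _ hD
    obtain ⟨s'', h₁, h₂⟩ := hY _ (hh a o p' hD htop fun h => nomatch h.symm.trans happ)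
    cases h₁.symm.trans happ
    exact h₂

theorem MuDef.mu [DecidableEq V] (X : V) (hF : MuDef ι F) :
    MuDef ι fun ρ => ⋂₀ {C | F (Function.update ρ X C) ⊆ C} := by
  obtain ⟨Q, hQ, rule, hrule, init, h⟩ := hF
  let g : (Q → (Option O × Q → Prop) → (V × P → Prop) → Prop) →
      Q → (Option O × Q → Prop) → (V × P → Prop) → Prop :=
    fun x q Y U => ∃ Y₀ U₀, x q Y₀ U₀ ∧ (∀ m, Y₀ m → Y m) ∧
      ∀ x, U₀ x → (x.1 = X ∧ Y (none, init x.2)) ∨ (x.1 ≠ X ∧ U x)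
  refine ⟨Q, hQ, fun s => g (rule s), hrule.comp g, init, fun ρ => ?_⟩
  refine Set.ext fun ⟨p, s⟩ => ⟨fun hc => hc _ ?_, fun hc C hC => ?_⟩
  · rw [Set.mem_ofPred, h]
    rintro ⟨p, s⟩ hc
    refine Holds.least (Z := fun s q => Holds ι (instRule (fun s => g (rule s)) ρ) s q) ?_ hc
    rintro s q Y ⟨U, hr, hU⟩ hY
    refine Holds.mk (fun m => Y m ∨ ∃ p, U (X, p) ∧ m = (none, init p))
      ⟨fun x => x.1 ≠ X ∧ U x, ⟨Y, U, hr, fun m => Or.inl, ?_⟩, ?_⟩ ?_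
    · rintro ⟨Y, p⟩ hx
      by_cases hYX : Y = X
      · subst hYX
        exact Or.inl ⟨rfl, Or.inr ⟨p, hx, rfl⟩⟩
      · exact Or.inr ⟨hYX, hYX, hx⟩
    · rintro ⟨Y, p⟩ ⟨hYX, hx⟩
      simpa [Function.update_of_ne hYX] using hU _ hx
    · rintro m (hm | ⟨p, hp, rfl⟩)
      · exact (hY m hm).imp fun s' h => ⟨h.1, h.2.2⟩
      · exact ⟨s, rfl, by simpa using hU _ hp⟩
  · have key : ∀ s q, Holds ι (instRule (fun s => g (rule s)) ρ) s q →
        Holds ι (instRule rule (Function.update ρ X C)) s q := by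
      intro s q hq
      refine Holds.least (Z := fun s q =>
        Holds ι (instRule rule (Function.update ρ X C)) s q) ?_ hq
      rintro s q Y ⟨U, ⟨Y₀, U₀, hr, hY₀, hU₀⟩, hU⟩ hY
      refine Holds.mk Y₀ ⟨U₀, hr, ?_⟩ fun m hm =>
        (hY m (hY₀ m hm)).imp fun s' h => ⟨h.1, h.2.2⟩
      rintro ⟨W, p⟩ hx
      rcases hU₀ _ hx with ⟨rfl, hp⟩ | ⟨hW, hp⟩
      · obtain ⟨s', h₁, -, h₃⟩ := hY _ hp
        cases h₁
        rw [Function.update_self]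
        apply hC
        rw [h]
        exact h₃
      · simpa [Function.update_of_ne hW] using hU _ hp
    apply hC
    rw [h]
    exact key s _ hc

theorem Mu.sem_congr {Prop0 : Type} [DecidableEq V] (Λ : P → Set Prop0) (φ : Mu Prop0 V)
    {ρ ρ' : V → Set (PConf P α k)} (h : ∀ X, Mu.Occurs X φ → ρ X = ρ' X) :
    Mu.sem D Λ φ ρ = Mu.sem D Λ φ ρ' := by
  have hupd : ∀ {θ : Mu Prop0 V} {ρ ρ' : V → Set (PConf P α k)} (X : V) (C),
      (∀ Y, Mu.Occurs Y θ → ρ Y = ρ' Y) → ∀ Y, Mu.Occurs Y θ →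
        Function.update ρ X C Y = Function.update ρ' X C Y := by
    intro θ ρ ρ' X C h Y hY
    by_cases hYX : Y = X
    · subst hYX
      simp
    · simp [hYX, h Y hY]
  induction φ generalizing ρ ρ' with
  | atom π => rfl
  | natom π => rfl
  | var X => exact h X rfl
  | or φ ψ ih₁ ih₂ | and φ ψ ih₁ ih₂ =>
    simp only [Mu.sem, ih₁ fun X hX => h X (Or.inl hX), ih₂ fun X hX => h X (Or.inr hX)]
  | dia φ ih | box φ ih => simp only [Mu.sem, ih h]
  | mu X φ ih | nu X φ ih => simp only [Mu.sem, ih (hupd X _ h)]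

theorem Mu.self_mem_Subf {Prop0 : Type} (φ : Mu Prop0 V) : φ ∈ Mu.Subf φ := by
  cases φ <;> simp [Mu.Subf]

/-- the valuation that agrees with `ρ` on `S` and with `ρ₀` elsewhere -/
noncomputable def override {X : Type} (S : Set V) (ρ₀ ρ : V → X) : V → X :=
  open Classical in fun Y => if Y ∈ S then ρ Y else ρ₀ Y

theorem override_empty {X : Type} (ρ₀ ρ : V → X) : override ∅ ρ₀ ρ = ρ₀ := by
  funext Y
  simp [override]

theorem update_override [DecidableEq V] {X : Type} (S : Set V) (ρ₀ ρ : V → X) (Y : V) (C : X) :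
    Function.update (override S ρ₀ ρ) Y C =
      override (insert Y S) ρ₀ (Function.update ρ Y C) := by
  funext Z
  by_cases hZ : Z = Y
  · subst hZ
    simp [override]
  · have hmem : Z ∈ insert Y S ↔ Z ∈ S := Set.mem_insert_iff.trans (or_iff_right hZ)
    by_cases hS : Z ∈ S
    · rw [Function.update_of_ne hZ, override, override, if_pos hS, if_pos (hmem.mpr hS),
        Function.update_of_ne hZ]
    · rw [Function.update_of_ne hZ, override, override, if_neg hS, if_neg (mt hmem.mp hS)]

theorem update_compl [DecidableEq V] {X : Type} (ρ : V → Set X) (Y : V) (C : Set X) :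
    (fun Z => (Function.update ρ Y C Z)ᶜ) = Function.update (fun Z => (ρ Z)ᶜ) Y Cᶜ := by
  funext Z
  by_cases hZ : Z = Y
  · subst hZ
    simp
  · simp [hZ]

theorem NuDef.nu [DecidableEq V] (X : V) (hF : NuDef ι F) :
    NuDef ι fun ρ => ⋃₀ {C | C ⊆ F (Function.update ρ X C)} := by
  unfold NuDef
  convert MuDef.mu X hF using 2 with ρ
  ext c
  simp only [Set.mem_compl_iff, Set.mem_sUnion, Set.mem_ofPred, not_exists, not_and,
    Set.mem_sInter, update_compl]
  constructor
  · intro h C hC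
    by_contra hc
    exact h Cᶜ (Set.compl_subset_comm.mp hC) hc
  · intro h C hC hc
    refine h Cᶜ ?_ hc
    rw [compl_compl]
    exact Set.compl_subset_compl.mpr hC

theorem Mu.sem_muDef_nuDef [Finite α] [Finite P] [Finite V] [Finite O] [DecidableEq V]
    {Prop0 : Type} (hι : ∀ x ∈ D, ∃ o, ι o = x.2.2.1) (Λ : P → Set Prop0)
    {ρ₀ : V → Set (PConf P α k)} (hρ₀ : ∀ X, RegConf (ρ₀ X)) (φ : Mu Prop0 V)
    (hφ : Mu.AltFree φ) (S : Set V) :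
    ((∀ ξ ∈ Mu.Subf φ, (∃ Y τ, ξ = Mu.nu Y τ) → ∀ X ∈ S, ¬ Mu.Occurs X ξ) →
      MuDef ι fun ρ => Mu.sem D Λ φ (override S ρ₀ ρ)) ∧
    ((∀ ξ ∈ Mu.Subf φ, (∃ Y τ, ξ = Mu.mu Y τ) → ∀ X ∈ S, ¬ Mu.Occurs X ξ) →
      NuDef ι fun ρ => Mu.sem D Λ φ (override S ρ₀ ρ)) := by
  have hatom : ∀ T : Set P, RegConf {c : PConf P α k | c.1 ∈ T} := fun T => RegFun.const fun p => p ∈ T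
  induction φ generalizing S with
  | atom π =>
    exact ⟨fun _ => .const (hatom {p | π ∈ Λ p}), fun _ => .const (hatom {p | π ∈ Λ p}).compl⟩
  | natom π =>
    exact ⟨fun _ => .const (hatom {p | π ∉ Λ p}), fun _ => .const (hatom {p | π ∉ Λ p}).compl⟩
  | var X =>
    by_cases hX : X ∈ S
    · simp only [Mu.sem, override, hX, if_true, NuDef, compl_compl]
      exact ⟨fun _ => .var X, fun _ => .var X⟩
    · simp only [Mu.sem, override, hX, if_false, NuDef]
      exact ⟨fun _ => .const (hρ₀ X), fun _ => .const (hρ₀ X).compl⟩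
  | or φ ψ ih₁ ih₂ =>
    have h₁ := ih₁ (fun ξ hξ => hφ ξ (Or.inr (Or.inl hξ))) S
    have h₂ := ih₂ (fun ξ hξ => hφ ξ (Or.inr (Or.inr hξ))) S
    refine ⟨fun h => .union (h₁.1 fun ξ hξ => h ξ (Or.inr (Or.inl hξ)))
      (h₂.1 fun ξ hξ => h ξ (Or.inr (Or.inr hξ))), fun h => ?_⟩
    simp only [NuDef, Mu.sem, Set.compl_union]
    exact .inter (h₁.2 fun ξ hξ => h ξ (Or.inr (Or.inl hξ)))
      (h₂.2 fun ξ hξ => h ξ (Or.inr (Or.inr hξ)))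
  | and φ ψ ih₁ ih₂ =>
    have h₁ := ih₁ (fun ξ hξ => hφ ξ (Or.inr (Or.inl hξ))) S
    have h₂ := ih₂ (fun ξ hξ => hφ ξ (Or.inr (Or.inr hξ))) S
    refine ⟨fun h => .inter (h₁.1 fun ξ hξ => h ξ (Or.inr (Or.inl hξ)))
      (h₂.1 fun ξ hξ => h ξ (Or.inr (Or.inr hξ))), fun h => ?_⟩
    simp only [NuDef, Mu.sem, Set.compl_inter]
    exact .union (h₁.2 fun ξ hξ => h ξ (Or.inr (Or.inl hξ)))
      (h₂.2 fun ξ hξ => h ξ (Or.inr (Or.inr hξ)))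
  | dia φ ih =>
    have h' := ih (fun ξ hξ => hφ ξ (Or.inr hξ)) S
    refine ⟨fun h => .dia hι (h'.1 fun ξ hξ => h ξ (Or.inr hξ)), fun h => ?_⟩
    unfold NuDef
    convert MuDef.box hι (h'.2 fun ξ hξ => h ξ (Or.inr hξ)) using 2 with ρ
    ext c
    simp [Mu.sem]
  | box φ ih =>
    have h' := ih (fun ξ hξ => hφ ξ (Or.inr hξ)) S
    refine ⟨fun h => .box hι (h'.1 fun ξ hξ => h ξ (Or.inr hξ)), fun h => ?_⟩
    unfold NuDef
    convert MuDef.dia hι (h'.2 fun ξ hξ => h ξ (Or.inr hξ)) using 2 with ρ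
    ext c
    simp [Mu.sem]
  | mu X θ ih =>
    have hmu : ∀ S : Set V, (∀ ξ ∈ Mu.Subf (.mu X θ), (∃ Y τ, ξ = Mu.nu Y τ) →
        ∀ Y ∈ S, ¬ Mu.Occurs Y ξ) →
        MuDef ι fun ρ => Mu.sem D Λ (.mu X θ) (override S ρ₀ ρ) := by
      intro S h
      simp only [Mu.sem, update_override]
      refine MuDef.mu X ((ih (fun ξ hξ => hφ ξ (Or.inr hξ)) (insert X S)).1 ?_)
      rintro ξ hξ hnu Y (rfl | hY)
      · exact (hφ _ (Mu.self_mem_Subf _)).1 _ θ rfl ξ hξ hnu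
      · exact h ξ (Or.inr hξ) hnu Y hY
    refine ⟨hmu S, fun h => ?_⟩
    have hreg := (hmu ∅ (by simp)).regConf hρ₀
    simp only [override_empty] at hreg
    have hconst : ∀ ρ, Mu.sem D Λ (.mu X θ) (override S ρ₀ ρ) = Mu.sem D Λ (.mu X θ) ρ₀ :=
      fun ρ => Mu.sem_congr Λ _ fun Y hY =>
        if_neg fun hYS => h _ (Mu.self_mem_Subf _) ⟨X, θ, rfl⟩ Y hYS hY
    simp only [NuDef, hconst]
    exact .const hreg.compl
  | nu X θ ih =>
    have hnu : ∀ S : Set V, (∀ ξ ∈ Mu.Subf (.nu X θ), (∃ Y τ, ξ = Mu.mu Y τ) →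
        ∀ Y ∈ S, ¬ Mu.Occurs Y ξ) →
        NuDef ι fun ρ => Mu.sem D Λ (.nu X θ) (override S ρ₀ ρ) := by
      intro S h
      simp only [Mu.sem, update_override]
      refine NuDef.nu X ((ih (fun ξ hξ => hφ ξ (Or.inr hξ)) (insert X S)).2 ?_)
      rintro ξ hξ hmu Y (rfl | hY)
      · exact (hφ _ (Mu.self_mem_Subf _)).2 _ θ rfl ξ hξ hmu
      · exact h ξ (Or.inr hξ) hmu Y hY
    refine ⟨fun h => ?_, hnu S⟩
    have hreg := (hnu ∅ (by simp)).regConf hρ₀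
    simp only [override_empty] at hreg
    have hconst : ∀ ρ, Mu.sem D Λ (.nu X θ) (override S ρ₀ ρ) = Mu.sem D Λ (.nu X θ) ρ₀ :=
      fun ρ => Mu.sem_congr Λ _ fun Y hY =>
        if_neg fun hYS => h _ (Mu.self_mem_Subf _) ⟨X, θ, rfl⟩ Y hYS hY
    simp only [hconst]
    exact .const hreg

end MuCalculus

/-- Given an order-`n` PDS `(P, D, Σ)` (here `n = k + 1`, with
bottom-of-stack symbol `⊥`), a labelling `Λ : P → 2^Prop`, a valuation `V` assigning a
regular set of configurations to each variable, and a formula `φ` of the alternation-free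
μ-calculus, one can construct an `n`-store multi-automaton `M` such that
`L(M) = ⟦φ⟧_V`; in particular the set of configurations satisfying `φ` is regular. -/
theorem alternation_free_mu_calculus_regular
    (k : ℕ) (α P Prop0 V : Type)
    [Finite α] [Finite P] [Finite Prop0] [Finite V] [DecidableEq V]
    (bot : α)
    (D : Set (P × α × Op α × P)) (hDfin : D.Finite)
    (hvalid : ∀ x ∈ D, Op.Valid (k + 1) x.2.2.1)
    (hbot : BotDisc bot D)
    (Λ : P → Set Prop0) (Vv : V → Set (PConf P α k))
    (hVreg : ∀ X : V, ∃ MX : MSA α P k,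
        MX.Lang = {x : AConf P α k | ∃ s, x.2 = some s ∧ (x.1, s) ∈ Vv X})
    (φ : Mu Prop0 V) (hφ : Mu.AltFree φ) :
    ∃ M : MSA α P k,
      M.Lang = {x : AConf P α k | ∃ s, x.2 = some s ∧ (x.1, s) ∈ Mu.sem D Λ φ Vv} := by
  have hreg : ∀ X, RegConf (Vv X) := fun X => regConf_of_lang _ (hVreg X).choose_spec
  let ι : (fun x : P × α × Op α × P => x.2.2.1) '' D → Op α := Subtype.val
  have : Finite ((fun x : P × α × Op α × P => x.2.2.1) '' D) := hDfin.image _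
  have h := ((Mu.sem_muDef_nuDef (ι := ι) (fun x hx => ⟨⟨_, x, hx, rfl⟩, rfl⟩) Λ hreg φ hφ
    ∅).1 (by simp)).regConf hreg
  simp only [override_empty] at h
  exact h.exists_lang

end HOPDS
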